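/- Consider a multi-unit auction with m ≥ 1 identical items and n bidders indexed 1,...,n, where each bidder i has a valuation v_i : {0,1,...,m} → ℝ with v_i(0) = 0 that is nondecreasing and has decreasing marginals (v_i(q+1) − v_i(q) ≤ v_i(q) − v_i(q−1) for all 1 ≤ q ≤ m−1). The Single-Minded mechanism works as follows. With probability 1/2 it sells the grand bundle to a bidder maximizing v_i(m), obtaining welfare max_i v_i(m). With the remaining probability 1/2 it draws independent fair coins σ : {1,...,n} → Bool, forms the sampled set S = {i : σ(i) = true}, sets the per-item price p = OPT(S)/(10m), and then processes the bidders not in S in increasing index order, maintaining a remaining supply r initialized to m: bidder i purchases some quantity q_i maximizing v_i(q) − p·q over 0 ≤ q ≤ r (any choice of maximizer), contributing v_i(q_i) to the welfare and decreasing r by q_i; let W(σ) denote the resulting total welfare. Then, for every choice of maximizers, (1/2)·max_i v_i(m) + (1/2)·E_σ[W(σ)] ≥ OPT/400, where OPT = OPT({1,...,n}); i.e., the mechanism is a 400-approximation to the optimal welfare for bidders with decreasing marginal valuations. -/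

import Mathlib

open scoped Classical

/-- Optimal welfare attainable by allocating the `m` identical items only among the
bidders in `T`, for general valuations `v`. -/
noncomputable def dmOPT (m : ℕ) {n : ℕ} (v : Fin n → ℕ → ℝ) (T : Finset (Fin n)) : ℝ :=
  sSup {w : ℝ | ∃ q : Fin n → ℕ, (∑ i ∈ T, q i) ≤ m ∧ w = ∑ i ∈ T, v i (q i)}

/-- The welfare of the uniform-pricing phase of the Single-Minded mechanism for general
valuations: given coins `σ` and a choice `Q` of purchased quantities, the bidders outside
the sampled set `S = {i : σ i = true}` are processed in increasing index order, bidder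
`i` purchasing `Q σ i r` items when `r` items remain, contributing `v i (Q σ i r)`. -/
noncomputable def dmWelfare (m : ℕ) {n : ℕ} (v : Fin n → ℕ → ℝ)
    (Q : (Fin n → Bool) → Fin n → ℕ → ℕ) (σ : Fin n → Bool) : ℝ :=
  (((List.finRange n).filter (fun i => !σ i)).foldl
    (fun wr i => (wr.1 + v i (Q σ i wr.2), wr.2 - Q σ i wr.2))
    ((0 : ℝ), m)).1

section ConcaveValuation

variable {m : ℕ} {u : ℕ → ℝ}

theorem valuation_mono_of_le (hmono : ∀ q, q < m → u q ≤ u (q + 1)) {a b : ℕ}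
    (hab : a ≤ b) (hb : b ≤ m) : u a ≤ u b := by
  induction b, hab using Nat.le_induction with
  | base => exact le_rfl
  | succ b _ ih => exact (ih (by omega)).trans (hmono b (by omega))

theorem marginal_add_le
    (hdec : ∀ q, 1 ≤ q → q + 1 ≤ m → u (q + 1) - u q ≤ u q - u (q - 1))
    (a b : ℕ) (h : a + b + 1 ≤ m) : u (a + b + 1) - u (a + b) ≤ u (b + 1) - u b := by
  induction a with
  | zero => simp
  | succ a ih =>
    have step := hdec (a + b + 1) (by omega) (by omega)
    rw [Nat.add_sub_cancel] at step
    rw [show a + 1 + b = a + b + 1 by omega]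
    exact step.trans (ih (by omega))

theorem valuation_add_le (h0 : u 0 = 0)
    (hdec : ∀ q, 1 ≤ q → q + 1 ≤ m → u (q + 1) - u q ≤ u q - u (q - 1))
    (a b : ℕ) (h : a + b ≤ m) : u (a + b) ≤ u a + u b := by
  induction b with
  | zero => simp [h0]
  | succ b ih =>
    have hstep := marginal_add_le hdec a b (by omega)
    have hprev := ih (by omega)
    rw [← Nat.add_assoc]
    linarith

theorem half_valuation_le (h0 : u 0 = 0) (hmono : ∀ q, q < m → u q ≤ u (q + 1))
    (hdec : ∀ q, 1 ≤ q → q + 1 ≤ m → u (q + 1) - u q ≤ u q - u (q - 1))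
    {a q : ℕ} (haq : a ≤ q) (hqa : q ≤ 2 * a) (hq : q ≤ m) : u q / 2 ≤ u a := by
  have hsub := valuation_add_le h0 hdec a (q - a) (by omega)
  rw [Nat.add_sub_cancel' haq] at hsub
  have hle := valuation_mono_of_le hmono (show q - a ≤ a by omega) (by omega)
  linarith

end ConcaveValuation

section Optimum

variable {m n : ℕ} {v : Fin n → ℕ → ℝ}

theorem dmOPT_values_finite (T : Finset (Fin n)) :
    {w : ℝ | ∃ q : Fin n → ℕ, (∑ i ∈ T, q i) ≤ m ∧ w = ∑ i ∈ T, v i (q i)}.Finite := by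
  refine ((Fintype.piFinset fun _ : Fin n => Finset.range (m + 1)).finite_toSet.image
    fun q => ∑ i ∈ T, v i (q i)).subset ?_
  rintro _ ⟨q, hq, rfl⟩
  refine ⟨fun i => if i ∈ T then q i else 0, ?_, ?_⟩
  · simp only [Finset.mem_coe, Fintype.mem_piFinset, Finset.mem_range]
    intro i
    split_ifs with hi
    · have := Finset.single_le_sum (f := q) (fun _ _ => Nat.zero_le _) hi
      omega
    · omega
  · exact Finset.sum_congr rfl fun i hi => by simp [hi]

theorem le_dmOPT (T : Finset (Fin n)) (q : Fin n → ℕ) (hq : ∑ i ∈ T, q i ≤ m) :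
    ∑ i ∈ T, v i (q i) ≤ dmOPT m v T :=
  le_csSup (dmOPT_values_finite T).bddAbove ⟨q, hq, rfl⟩

theorem exists_eq_dmOPT (T : Finset (Fin n)) :
    ∃ q : Fin n → ℕ, ∑ i ∈ T, q i ≤ m ∧ dmOPT m v T = ∑ i ∈ T, v i (q i) :=
  Set.Nonempty.csSup_mem
    (s := {w : ℝ | ∃ q : Fin n → ℕ, (∑ i ∈ T, q i) ≤ m ∧ w = ∑ i ∈ T, v i (q i)})
    ⟨_, fun _ => 0, by simp, rfl⟩ (dmOPT_values_finite T)

theorem dmOPT_nonneg (h0 : ∀ i, v i 0 = 0) (T : Finset (Fin n)) : 0 ≤ dmOPT m v T := by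
  simpa [h0] using le_dmOPT (m := m) (v := v) T (fun _ => 0) (by simp)

theorem dmOPT_le_univ (h0 : ∀ i, v i 0 = 0) (T : Finset (Fin n)) :
    dmOPT m v T ≤ dmOPT m v Finset.univ := by
  obtain ⟨q, hq, hT⟩ := exists_eq_dmOPT (m := m) (v := v) T
  have key := le_dmOPT (m := m) (v := v) Finset.univ (fun i => if i ∈ T then q i else 0)
    (by simpa [Finset.sum_ite_mem] using hq)
  have hsum : ∑ i, v i (if i ∈ T then q i else 0) = ∑ i ∈ T, v i (q i) := by
    simp [apply_ite (v _), h0, Finset.sum_ite_mem]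
  rw [hT, ← hsum]
  exact key

end Optimum

/-- Sequential sales at price `p`: the surplus of the bidders is nonnegative, and it is at least
`∑ (v i (z i) / 2 - p * z i)` for any target quantities `z` if half of the items stay unsold. -/
theorem sequential_sale_surplus {m n : ℕ} {v : Fin n → ℕ → ℝ} {p : ℝ} (hp : 0 ≤ p)
    (h0 : ∀ i, v i 0 = 0)
    (hmono : ∀ i q, q < m → v i q ≤ v i (q + 1))
    (hdec : ∀ i q, 1 ≤ q → q + 1 ≤ m → v i (q + 1) - v i q ≤ v i q - v i (q - 1))
    {b : Fin n → ℕ → ℕ} (hble : ∀ i r, b i r ≤ r)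
    (hbmax : ∀ i r q, q ≤ r → v i q - p * q ≤ v i (b i r) - p * b i r)
    {z : Fin n → ℕ} (hz : ∀ i, z i ≤ m) (l : List (Fin n)) (w : ℝ) (r : ℕ) :
    let s := l.foldl (fun wr i => (wr.1 + v i (b i wr.2), wr.2 - b i wr.2)) (w, r)
    s.2 ≤ r ∧ p * ((r : ℝ) - s.2) ≤ s.1 - w ∧
      (m ≤ 2 * s.2 →
        (l.map fun i => v i (z i) / 2 - p * z i).sum ≤ s.1 - w - p * ((r : ℝ) - s.2)) := by
  induction l generalizing w r with
  | nil => simp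
  | cons i l ih =>
    obtain ⟨hle, hrev, hsurplus⟩ := ih (w + v i (b i r)) (r - b i r)
    simp only [List.foldl_cons, List.map_cons, List.sum_cons]
    set s := l.foldl (fun wr i => (wr.1 + v i (b i wr.2), wr.2 - b i wr.2))
      (w + v i (b i r), r - b i r)
    rw [Nat.cast_sub (hble i r)] at hrev hsurplus
    have hzero := hbmax i r 0 (Nat.zero_le r)
    simp only [h0, Nat.cast_zero, mul_zero, sub_zero] at hzero
    refine ⟨by omega, by linarith, fun hs => ?_⟩
    have hbuy := hbmax i r (min (z i) r) (min_le_right _ _)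
    have hhalf := half_valuation_le (h0 i) (hmono i) (hdec i) (min_le_left (z i) r)
      (by have := hz i; omega) (hz i)
    have hcost : p * (min (z i) r : ℕ) ≤ p * z i :=
      mul_le_mul_of_nonneg_left (Nat.cast_le.mpr (min_le_left _ _)) hp
    have hrest := hsurplus hs
    linarith

theorem pricing_phase_bound {m n : ℕ} (hm : 1 ≤ m) {v : Fin n → ℕ → ℝ}
    (h0 : ∀ i, v i 0 = 0)
    (hmono : ∀ i q, q < m → v i q ≤ v i (q + 1))
    (hdec : ∀ i q, 1 ≤ q → q + 1 ≤ m → v i (q + 1) - v i q ≤ v i q - v i (q - 1))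
    {Q : (Fin n → Bool) → Fin n → ℕ → ℕ} (hQle : ∀ σ i r, Q σ i r ≤ r)
    (σ : Fin n → Bool)
    (hQmax : ∀ i r q, q ≤ r →
      v i q - (dmOPT m v (Finset.univ.filter fun j => σ j = true) / (10 * m)) * q ≤
      v i (Q σ i r) -
        (dmOPT m v (Finset.univ.filter fun j => σ j = true) / (10 * m)) * (Q σ i r))
    {z : Fin n → ℕ} (hz : ∑ i, z i ≤ m) (hopt : dmOPT m v Finset.univ = ∑ i, v i (z i)) :
    0 ≤ dmWelfare m v Q σ ∧
    dmOPT m v Finset.univ ^ 2 -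
        4 * (∑ i, if σ i = true then v i (z i) else -v i (z i)) ^ 2 ≤
      80 * dmOPT m v Finset.univ * dmWelfare m v Q σ := by
  set S := Finset.univ.filter fun j => σ j = true
  set U := Finset.univ.filter fun j => ¬ σ j = true with hU
  have hm0 : (0 : ℝ) < m := by exact_mod_cast hm
  have hX := dmOPT_nonneg (m := m) h0 S
  have hXO := dmOPT_le_univ (m := m) h0 S
  have hAX := le_dmOPT (m := m) (v := v) S z
    ((Finset.sum_le_sum_of_subset (Finset.subset_univ S)).trans hz)
  have hAB : ∑ i ∈ S, v i (z i) + ∑ i ∈ U, v i (z i) = ∑ i, v i (z i) :=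
    Finset.sum_filter_add_sum_filter_not _ _ _
  have hdiff : (∑ i, if σ i = true then v i (z i) else -v i (z i)) =
      ∑ i ∈ S, v i (z i) - ∑ i ∈ U, v i (z i) := by
    rw [Finset.sum_ite, Finset.sum_neg_distrib, sub_eq_add_neg]
  set p := dmOPT m v S / (10 * m) with hpdef
  have hp : 0 ≤ p := by positivity
  have hpm : p * m = dmOPT m v S / 10 := by
    rw [hpdef]
    field_simp
  obtain ⟨hle, hrev, hsurplus⟩ := sequential_sale_surplus hp h0 hmono hdec (hQle σ) hQmax
    (fun i => (Finset.single_le_sum (f := z) (fun _ _ => Nat.zero_le _)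
      (Finset.mem_univ i)).trans hz)
    ((List.finRange n).filter fun i => !σ i) 0 m
  have hW : (((List.finRange n).filter fun i => !σ i).foldl
      (fun wr i => (wr.1 + v i (Q σ i wr.2), wr.2 - Q σ i wr.2)) ((0 : ℝ), m)).1 =
      dmWelfare m v Q σ := rfl
  rw [hW] at hrev hsurplus
  set r := (((List.finRange n).filter fun i => !σ i).foldl
      (fun wr i => (wr.1 + v i (Q σ i wr.2), wr.2 - Q σ i wr.2)) ((0 : ℝ), m)).2
  have hlist : (((List.finRange n).filter fun i => !σ i).map
      fun i => v i (z i) / 2 - p * z i).sum = ∑ i ∈ U, (v i (z i) / 2 - p * z i) := by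
    rw [← List.sum_toFinset _ ((List.nodup_finRange n).filter _)]
    congr 1
    ext i
    simp [hU]
  rw [hlist, Finset.sum_sub_distrib, ← Finset.sum_div, ← Finset.mul_sum] at hsurplus
  have hUm : p * ∑ i ∈ U, (z i : ℝ) ≤ p * m := by
    refine mul_le_mul_of_nonneg_left ?_ hp
    exact_mod_cast (Finset.sum_le_sum_of_subset (Finset.subset_univ U)).trans hz
  have hrm : (r : ℝ) ≤ m := Nat.cast_le.mpr hle
  have hsold : 0 ≤ p * ((m : ℝ) - r) := mul_nonneg hp (sub_nonneg.mpr hrm)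
  rw [hdiff]
  set O := dmOPT m v Finset.univ
  set A := ∑ i ∈ S, v i (z i)
  set B := ∑ i ∈ U, v i (z i)
  have hWnonneg : 0 ≤ dmWelfare m v Q σ := by linarith
  have hO : 0 ≤ O := hX.trans hXO
  refine ⟨hWnonneg, ?_⟩
  by_cases hgood : O / 4 ≤ A ∧ O / 4 ≤ B
  · have hbound : O ≤ 80 * dmWelfare m v Q σ := by
      by_cases hr : m ≤ 2 * r
      · have := hsurplus hr
        linarith
      · have hr' : 2 * (r : ℝ) ≤ m := by exact_mod_cast (not_le.mp hr).le
        have := mul_le_mul_of_nonneg_left hr' hp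
        linarith
    nlinarith [sq_nonneg (A - B), mul_le_mul_of_nonneg_left hbound hO]
  · have hfar : O ^ 2 ≤ 4 * (A - B) ^ 2 := by
      rcases not_and_or.mp hgood with h | h <;> nlinarith
    have := mul_nonneg hO hWnonneg
    linarith

theorem sum_signs_mul_eq_zero {n : ℕ} (x : Fin n → ℝ) {i j : Fin n} (hij : i ≠ j) :
    ∑ σ : Fin n → Bool, (if σ i = true then x i else -x i) *
      (if σ j = true then x j else -x j) = 0 := by
  have hflip : Function.Involutive fun σ : Fin n → Bool => Function.update σ i (!σ i) := by
    intro σ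
    simp
  have h := Equiv.sum_comp (Function.Involutive.toPerm _ hflip) fun σ : Fin n → Bool =>
    (if σ i = true then x i else -x i) * (if σ j = true then x j else -x j)
  have hneg : ∀ σ : Fin n → Bool,
      (if (Function.Involutive.toPerm _ hflip) σ i = true then x i else -x i) *
        (if (Function.Involutive.toPerm _ hflip) σ j = true then x j else -x j) =
      -((if σ i = true then x i else -x i) * (if σ j = true then x j else -x j)) := by
    intro σ
    cases hi : σ i <;> cases hj : σ j <;> simp [hi, hj, hij.symm]
  simp only [hneg, Finset.sum_neg_distrib] at h
  linarith

theorem sum_sq_signed_sum {n : ℕ} (x : Fin n → ℝ) :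
    ∑ σ : Fin n → Bool, (∑ i, if σ i = true then x i else -x i) ^ 2 =
      Fintype.card (Fin n → Bool) * ∑ i, x i ^ 2 := by
  simp only [sq, Finset.sum_mul_sum]
  rw [Finset.sum_comm, Finset.mul_sum]
  refine Finset.sum_congr rfl fun i _ => ?_
  rw [Finset.sum_comm, Finset.sum_eq_single i]
  · have : ∀ σ : Fin n → Bool, (if σ i = true then x i else -x i) *
        (if σ i = true then x i else -x i) = x i * x i := by
      intro σ
      split_ifs <;> ring
    simp only [this, Finset.sum_const, Finset.card_univ, nsmul_eq_mul]
  · exact fun j _ hj => sum_signs_mul_eq_zero x hj.symm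
  · simp

/-- For bidders with nondecreasing valuations with decreasing marginals, the Single-Minded
mechanism—which with probability `1/2` sells the grand bundle to a bidder maximizing
`v i m` and with probability `1/2` samples `S`, sets the per-item price
`p = OPT(S)/(10m)`, and lets the remaining bidders in order purchase a quantity
maximizing `v i q − p·q` subject to the remaining supply—is a `400`-approximation to the
optimal welfare, for every choice of maximizers `Q`. -/
theorem decreasing_marginals_400_approx (m n : ℕ) (hm : 1 ≤ m) (hn : 0 < n)
    (v : Fin n → ℕ → ℝ)
    (h0 : ∀ i, v i 0 = 0)
    (hmono : ∀ i q, q < m → v i q ≤ v i (q + 1))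
    (hdec : ∀ i q, 1 ≤ q → q + 1 ≤ m → v i (q + 1) - v i q ≤ v i q - v i (q - 1))
    (Q : (Fin n → Bool) → Fin n → ℕ → ℕ)
    (hQle : ∀ σ i r, Q σ i r ≤ r)
    (hQmax : ∀ σ i r q, q ≤ r →
      v i q - (dmOPT m v (Finset.univ.filter fun j => σ j = true) / (10 * m)) * q ≤
      v i (Q σ i r) -
        (dmOPT m v (Finset.univ.filter fun j => σ j = true) / (10 * m)) * (Q σ i r)) :
    dmOPT m v Finset.univ / 400 ≤
      (1 / 2) * (⨆ i, v i m) +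
      (1 / 2) * ((∑ σ : Fin n → Bool, dmWelfare m v Q σ) /
        (Fintype.card (Fin n → Bool))) := by
  obtain ⟨z, hz, hopt⟩ := exists_eq_dmOPT (m := m) (v := v) Finset.univ
  have hzm : ∀ i, z i ≤ m := fun i =>
    (Finset.single_le_sum (f := z) (fun _ _ => Nat.zero_le _) (Finset.mem_univ i)).trans hz
  have hvm : ∀ i, v i (z i) ≤ ⨆ i, v i m := fun i =>
    (valuation_mono_of_le (hmono i) (hzm i) le_rfl).trans
      (le_ciSup (Set.finite_range fun i => v i m).bddAbove i)
  have hvnonneg : ∀ i, 0 ≤ v i (z i) := fun i =>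
    (h0 i).symm.le.trans (valuation_mono_of_le (hmono i) (Nat.zero_le _) (hzm i))
  have hM : 0 ≤ ⨆ i, v i m := (hvnonneg ⟨0, hn⟩).trans (hvm ⟨0, hn⟩)
  have hsq : ∑ i, v i (z i) ^ 2 ≤ (⨆ i, v i m) * dmOPT m v Finset.univ := by
    rw [hopt, Finset.mul_sum]
    refine Finset.sum_le_sum fun i _ => ?_
    rw [sq]
    exact mul_le_mul_of_nonneg_right (hvm i) (hvnonneg i)
  have hpoint : ∀ σ, 0 ≤ dmWelfare m v Q σ ∧ dmOPT m v Finset.univ ^ 2 -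
        4 * (∑ i, if σ i = true then v i (z i) else -v i (z i)) ^ 2 ≤
      80 * dmOPT m v Finset.univ * dmWelfare m v Q σ := fun σ =>
    pricing_phase_bound hm h0 hmono hdec hQle σ (hQmax σ) hz hopt
  have htotal := Finset.sum_le_sum fun σ (_ : σ ∈ Finset.univ) => (hpoint σ).2
  rw [Finset.sum_sub_distrib, ← Finset.mul_sum, ← Finset.mul_sum, Finset.sum_const,
    Finset.card_univ, nsmul_eq_mul, sum_sq_signed_sum] at htotal
  have hcard : (0 : ℝ) < Fintype.card (Fin n → Bool) := by exact_mod_cast Fintype.card_pos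
  set N : ℝ := (Fintype.card (Fin n → Bool) : ℝ)
  set E := (∑ σ : Fin n → Bool, dmWelfare m v Q σ) / N with hE
  have hsum : ∑ σ : Fin n → Bool, dmWelfare m v Q σ = N * E := by
    rw [hE]
    field_simp
  rw [hsum] at htotal
  set M := ⨆ i, v i m
  set O := dmOPT m v Finset.univ
  have hmean : O ^ 2 - 4 * ∑ i, v i (z i) ^ 2 ≤ 80 * O * E :=
    le_of_mul_le_mul_left (by linarith) hcard
  have hO : 0 ≤ O := dmOPT_nonneg h0 _
  rcases hO.eq_or_lt with hO0 | hOpos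
  · have : 0 ≤ E := by
      rw [hE]
      exact div_nonneg (Finset.sum_nonneg fun σ _ => (hpoint σ).1) hcard.le
    linarith
  · have : O - 4 * M ≤ 80 * E := le_of_mul_le_mul_left (by nlinarith) hOpos
    linarith
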